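/- Let α ≥ β ≥ 0 be integers with β + 1 ≤ α + 1. Then for every integer j ≥ 1: I_j((β+1,β+1),(α,β)) = −p³ if 1 ≤ j < β + 1; = 1 − p if j = β + 1 and β + 1 < α + 1; = 1 if j = β + 1 = α + 1; and = 1 if j > β + 1. -/

import Mathlib

/-- The symbol `[u,v]` of Hironaka, for integers `u ≥ v ≥ 0`. -/
noncomputable def bsym (p u v : ℕ) : ℚ :=
  (∏ i ∈ Finset.Icc 1 u, (1 - (-(p : ℚ))⁻¹ ^ i)) /
    ((∏ i ∈ Finset.Icc 1 v, (1 - (-(p : ℚ))⁻¹ ^ i)) *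
      (∏ i ∈ Finset.Icc 1 (u - v), (1 - (-(p : ℚ))⁻¹ ^ i)))

/-- For a pair `a = (a₁, a₂)`, the quantity `a'_i = #{j ∈ {1,2} : a_j ≥ i}`. -/
def dualCt (a : ℕ × ℕ) (i : ℕ) : ℕ :=
  (if i ≤ a.1 then 1 else 0) + (if i ≤ a.2 then 1 else 0)

/-- Hironaka's local factor `I_j(μ, λ)`, for pairs `μ = (c,d)`, `λ = (λ₁,λ₂)`. -/
noncomputable def hirI (p : ℕ) (μ lam : ℕ × ℕ) (j : ℕ) : ℚ :=
  ∑ i ∈ Finset.Icc (dualCt μ (j + 1))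
      (min (dualCt (lam.1 + 1, lam.2 + 1) (j + 1)) (dualCt μ j)),
    (-(p : ℚ)) ^ (i * (2 * dualCt (lam.1 + 1, lam.2 + 1) (j + 1) + 1 - i) / 2) *
      bsym p (dualCt (lam.1 + 1, lam.2 + 1) (j + 1) - dualCt μ (j + 1))
        (dualCt (lam.1 + 1, lam.2 + 1) (j + 1) - i) *
      bsym p (dualCt (lam.1 + 1, lam.2 + 1) j - i)
        (dualCt (lam.1 + 1, lam.2 + 1) j - dualCt μ j)

theorem one_sub_neg_inv_pow_ne_zero {p : ℕ} (hp : 1 < p) {i : ℕ} (hi : i ≠ 0) :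
    1 - (-(p : ℚ))⁻¹ ^ i ≠ 0 := by
  have hp' : (1 : ℚ) < p := by exact_mod_cast hp
  intro h
  have h1 : (-(p : ℚ))⁻¹ ^ i = 1 := (sub_eq_zero.mp h).symm
  have h2 : ((p : ℚ)) ^ i = 1 := by
    simpa using congrArg abs h1
  exact (one_lt_pow₀ hp' hi).ne' h2

theorem prod_one_sub_neg_inv_pow_ne_zero {p : ℕ} (hp : 1 < p) (u : ℕ) :
    ∏ i ∈ Finset.Icc 1 u, (1 - (-(p : ℚ))⁻¹ ^ i) ≠ 0 :=
  Finset.prod_ne_zero_iff.mpr fun _ hi =>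
    one_sub_neg_inv_pow_ne_zero hp (Nat.one_le_iff_ne_zero.mp (Finset.mem_Icc.mp hi).1)

theorem bsym_self {p : ℕ} (hp : 1 < p) (u : ℕ) : bsym p u u = 1 := by
  simpa [bsym] using prod_one_sub_neg_inv_pow_ne_zero hp u

theorem bsym_zero_right {p : ℕ} (hp : 1 < p) (u : ℕ) : bsym p u 0 = 1 := by
  simpa [bsym] using prod_one_sub_neg_inv_pow_ne_zero hp u

theorem dualCt_of_le {a : ℕ × ℕ} {i : ℕ} (h₁ : i ≤ a.1) (h₂ : i ≤ a.2) : dualCt a i = 2 := by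
  simp [dualCt, h₁, h₂]

theorem dualCt_of_le_of_lt {a : ℕ × ℕ} {i : ℕ} (h₁ : i ≤ a.1) (h₂ : a.2 < i) :
    dualCt a i = 1 := by
  simp [dualCt, h₁, h₂]

theorem dualCt_of_lt {a : ℕ × ℕ} {i : ℕ} (h₁ : a.1 < i) (h₂ : a.2 < i) : dualCt a i = 0 := by
  simp [dualCt, h₁, h₂]

theorem statement11 (p : ℕ) (hp : p.Prime) (hodd : Odd p)
    (α β : ℕ) (hβα : β ≤ α)
    (j : ℕ) (hj : 1 ≤ j) :
    (j < β + 1 → hirI p (β + 1, β + 1) (α, β) j = -(p : ℚ) ^ 3) ∧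
    (j = β + 1 ∧ β + 1 < α + 1 → hirI p (β + 1, β + 1) (α, β) j = 1 - (p : ℚ)) ∧
    (j = β + 1 ∧ β + 1 = α + 1 → hirI p (β + 1, β + 1) (α, β) j = 1) ∧
    (β + 1 < j → hirI p (β + 1, β + 1) (α, β) j = 1) := by
  have hp1 : 1 < p := hp.one_lt
  refine ⟨fun h => ?_, fun ⟨h, h'⟩ => ?_, fun ⟨h, h'⟩ => ?_, fun h => ?_⟩
  · rw [hirI, dualCt_of_le (a := (β + 1, β + 1)) (i := j + 1) (by grind) (by grind),
      dualCt_of_le (a := (β + 1, β + 1)) (i := j) (by grind) (by grind),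
      dualCt_of_le (i := j + 1) (by grind) (by grind),
      dualCt_of_le (i := j) (by grind) (by grind)]
    simp [bsym_self hp1, Odd.neg_pow (by decide : Odd 3)]
  · rw [hirI, dualCt_of_lt (a := (β + 1, β + 1)) (i := j + 1) (by grind) (by grind),
      dualCt_of_le (a := (β + 1, β + 1)) (i := j) (by grind) (by grind),
      dualCt_of_le_of_lt (i := j + 1) (by grind) (by grind),
      dualCt_of_le (i := j) (by grind) (by grind)]
    have hI : Finset.Icc 0 (min 1 2) = {0, 1} := by decide
    rw [hI, Finset.sum_pair zero_ne_one]
    simp [bsym_self hp1, bsym_zero_right hp1, sub_eq_add_neg]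
  · rw [hirI, dualCt_of_lt (a := (β + 1, β + 1)) (i := j + 1) (by grind) (by grind),
      dualCt_of_lt (i := j + 1) (by grind) (by grind),
      dualCt_of_le (a := (β + 1, β + 1)) (i := j) (by grind) (by grind),
      dualCt_of_le (i := j) (by grind) (by grind)]
    simp [bsym_self hp1, bsym_zero_right hp1]
  · rw [hirI, dualCt_of_lt (a := (β + 1, β + 1)) (i := j + 1) (by grind) (by grind),
      dualCt_of_lt (a := (β + 1, β + 1)) (i := j) (by grind) (by grind)]
    simp [bsym_self hp1]
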